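/- Let {fe_l}_{l∈L} be an equilibrium flow of the traffic network with corresponding equilibrium densities {ρe_l}_{l∈L}. If fe_l < Φout_l(ρe_l) for some link l ∈ L, then there exists an ordinary link k ∈ O with fe_k = Φcrit_k. (Claim in the proof of Proposition 3) -/

import Mathlib

open scoped BigOperators ENNReal

/-- A traffic network: a finite directed acyclic graph with junctions `V`,
ordinary links `O` and onramps `R`, together with jam densities, demand and
supply functions and split ratios, satisfying the standing assumptions of the
model (Assumptions 1–3 and the structural assumptions). -/
structure TrafficNetwork (V O R : Type) [Fintype V] [Fintype O] [Fintype R]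
    [DecidableEq V] [DecidableEq O] [DecidableEq R] where
  /-- head junction of each link -/
  head : O ⊕ R → V
  /-- tail junction of each ordinary link (onramps have no tail) -/
  tail : O → V
  /-- jam density of each ordinary link -/
  ρjam : O → ℝ
  /-- demand function of each link -/
  Φout : O ⊕ R → ℝ → ℝ
  /-- supply function of each ordinary link -/
  Φin : O → ℝ → ℝ
  /-- split ratios -/
  β : O ⊕ R → O → ℝ
  ρjam_pos : ∀ l, 0 < ρjam l
  Φout_strictMono : ∀ l : O, StrictMonoOn (Φout (Sum.inl l)) (Set.Icc 0 (ρjam l))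
  Φout_zero : ∀ l : O ⊕ R, Φout l 0 = 0
  Φout_nonneg : ∀ l : O, ∀ x ∈ Set.Icc 0 (ρjam l), 0 ≤ Φout (Sum.inl l) x
  Φin_strictAnti : ∀ l : O, StrictAntiOn (Φin l) (Set.Icc 0 (ρjam l))
  Φin_nonneg : ∀ l : O, ∀ x ∈ Set.Icc 0 (ρjam l), 0 ≤ Φin l x
  Φin_jam : ∀ l : O, Φin l (ρjam l) = 0
  ΦoutR_strictMono : ∀ r : R, StrictMonoOn (Φout (Sum.inr r)) (Set.Ici 0)
  ΦoutR_nonneg : ∀ r : R, ∀ x ∈ Set.Ici (0 : ℝ), 0 ≤ Φout (Sum.inr r) x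
  ΦoutR_bddAbove : ∀ r : R, BddAbove (Φout (Sum.inr r) '' Set.Ici 0)
  β_nonneg : ∀ l k, 0 ≤ β l k
  β_le_one : ∀ l k, β l k ≤ 1
  β_support : ∀ l k, 0 < β l k → head l = tail k
  β_pos : ∀ (l : O ⊕ R) (k : O), head l = tail k → 0 < β l k
  β_sum_le_one : ∀ l : O ⊕ R,
    ∑ k ∈ Finset.univ.filter (fun k : O => tail k = head l), β l k ≤ 1
  acyclic : ∃ rank : V → ℕ, ∀ l : O, rank (tail l) < rank (head (Sum.inl l))
  Lin_nonempty : ∀ v : V, ∃ l : O ⊕ R, head l = v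
  ramp_out_nonempty : ∀ r : R, ∃ k : O, tail k = head (Sum.inr r)

namespace TrafficNetwork

variable {V O R : Type} [Fintype V] [Fintype O] [Fintype R]
  [DecidableEq V] [DecidableEq O] [DecidableEq R]
variable (N : TrafficNetwork V O R)

/-- links incoming to a junction -/
def Lin (v : V) : Finset (O ⊕ R) := Finset.univ.filter (fun l => N.head l = v)

/-- (ordinary) links outgoing from a junction -/
def Lout (v : V) : Finset O := Finset.univ.filter (fun k => N.tail k = v)

/-- continuous differentiability of supply and demand on the interiors of their domains -/
def C1 : Prop :=
  (∀ l : O, ContDiffOn ℝ 1 (N.Φout (Sum.inl l)) (Set.Ioo 0 (N.ρjam l))) ∧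
  (∀ l : O, ContDiffOn ℝ 1 (N.Φin l) (Set.Ioo 0 (N.ρjam l))) ∧
  (∀ r : R, ContDiffOn ℝ 1 (N.Φout (Sum.inr r)) (Set.Ioi 0))

/-- the derivative bounds of Assumption 1 -/
def DerivBounds : Prop :=
  (∀ l : O, ∃ M : ℝ, ∀ x ∈ Set.Ioo 0 (N.ρjam l),
      derivWithin (N.Φout (Sum.inl l)) (Set.Ioo 0 (N.ρjam l)) x ≤ M) ∧
  (∀ l : O, ∃ M : ℝ, ∀ x ∈ Set.Ioo 0 (N.ρjam l),
      M ≤ derivWithin (N.Φin l) (Set.Ioo 0 (N.ρjam l)) x) ∧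
  (∀ r : R, ∃ M : ℝ, 0 < M ∧ ∀ x ∈ Set.Ioi (0 : ℝ),
      derivWithin (N.Φout (Sum.inr r)) (Set.Ioi 0) x ≤ M / (1 + x) ^ 2)

/-- full regularity (Assumption 1) -/
def Regular : Prop := N.C1 ∧ N.DerivBounds

/-- For a vector of link demands `δ` and ordinary densities `ρO`, the PP/FIFO scale
factor at junction `v`: the largest `α ∈ [0,1]` such that
`α ⬝ Σ_{j ∈ L^in_v} β_{jk} δ_j ≤ Φin_k(ρ_k)` for every `k ∈ L^out_v`.
(If `L^out_v = ∅` this equals `1`.) -/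
noncomputable def αgen (δ : O ⊕ R → ℝ) (ρO : O → ℝ) (v : V) : ℝ :=
  sSup {a : ℝ | a ∈ Set.Icc (0 : ℝ) 1 ∧
    ∀ k ∈ N.Lout v, a * ∑ j ∈ N.Lin v, N.β j k * δ j ≤ N.Φin k (ρO k)}

/-- generic PP/FIFO outflow given demands `δ` and ordinary densities `ρO` -/
noncomputable def foutGen (δ : O ⊕ R → ℝ) (ρO : O → ℝ) (l : O ⊕ R) : ℝ :=
  N.αgen δ ρO (N.head l) * δ l

/-- generic PP/FIFO inflow of an ordinary link -/
noncomputable def finGen (δ : O ⊕ R → ℝ) (ρO : O → ℝ) (l : O) : ℝ :=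
  ∑ k ∈ N.Lin (N.tail l), N.β k l * N.foutGen δ ρO k

/-- link demands at density `ρ` -/
def demand (ρ : O ⊕ R → ℝ) (l : O ⊕ R) : ℝ := N.Φout l (ρ l)

/-- PP/FIFO scale factor at junction `v` at density `ρ` -/
noncomputable def αjunc (ρ : O ⊕ R → ℝ) (v : V) : ℝ :=
  N.αgen (N.demand ρ) (fun k => ρ (Sum.inl k)) v

/-- PP/FIFO outflow `fout_l(ρ)` -/
noncomputable def fout (ρ : O ⊕ R → ℝ) : O ⊕ R → ℝ :=
  N.foutGen (N.demand ρ) (fun k => ρ (Sum.inl k))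

/-- PP/FIFO inflow `fin_l(ρ)` of an ordinary link -/
noncomputable def fin (ρ : O ⊕ R → ℝ) (l : O) : ℝ :=
  N.finGen (N.demand ρ) (fun k => ρ (Sum.inl k)) l

/-- the state space `D` -/
def memD (ρ : O ⊕ R → ℝ) : Prop :=
  (∀ r : R, 0 ≤ ρ (Sum.inr r)) ∧ ∀ l : O, ρ (Sum.inl l) ∈ Set.Icc 0 (N.ρjam l)

/-- the state space `D` as a set -/
def Dset : Set (O ⊕ R → ℝ) := {ρ | N.memD ρ}

/-- `ρe ∈ D` is an equilibrium density for the constant input flow `d` -/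
def IsEquilibrium (d : R → ℝ) (ρe : O ⊕ R → ℝ) : Prop :=
  N.memD ρe ∧ (∀ r : R, N.fout ρe (Sum.inr r) = d r) ∧
    ∀ l : O, N.fout ρe (Sum.inl l) = N.fin ρe l

/-- the input flow `d` is feasible -/
def Feasible (d : R → ℝ) : Prop := ∃ ρe, N.IsEquilibrium d ρe

/-- `x` is the critical density of ordinary link `l`, where demand equals supply;
`Φcrit_l = Φout_l x = Φin_l x`. -/
def IsCrit (l : O) (x : ℝ) : Prop :=
  x ∈ Set.Icc 0 (N.ρjam l) ∧ N.Φout (Sum.inl l) x = N.Φin l x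

/-- supremum `Φ̄out_r` of the demand of onramp `r` -/
noncomputable def Φbar (r : R) : ℝ := sSup (N.Φout (Sum.inr r) '' Set.Ici 0)

/-- the routing matrix `A`, `A_{lk} = β_{kl}` for `l,k ∈ O` -/
def Amat : Matrix O O ℝ := Matrix.of fun l k => N.β (Sum.inl k) l

/-- the input routing matrix `B`, `B_{lr} = β_{rl}` for `l ∈ O`, `r ∈ R` -/
def Bmat : Matrix O R ℝ := Matrix.of fun l r => N.β (Sum.inr r) l

/-- the vector field `F` of the dynamics `ρ̇ = F(ρ)` with constant input `d` -/
noncomputable def Fvec (d : R → ℝ) (ρ : O ⊕ R → ℝ) : O ⊕ R → ℝ :=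
  Sum.elim (fun l => N.fin ρ l - N.fout ρ (Sum.inl l))
    (fun r => d r - N.fout ρ (Sum.inr r))

/-- `ρ : ℝ → D` is a trajectory of the network dynamics (for `t ≥ 0`) -/
noncomputable def IsTrajectory (d : R → ℝ) (ρ : ℝ → O ⊕ R → ℝ) : Prop :=
  ∀ t : ℝ, 0 ≤ t → HasDerivAt ρ (N.Fvec d (ρ t)) t

/-! ### Generalized (extended) state allowing infinite onramp densities -/

/-- demand vector for an extended state, where an onramp with infinite density
has demand `Φ̄out` -/
noncomputable def δext (ρO : O → ℝ) (ρR : R → ℝ≥0∞) : O ⊕ R → ℝ :=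
  Sum.elim (fun l => N.Φout (Sum.inl l) (ρO l))
    (fun r => if ρR r = ⊤ then N.Φbar r else N.Φout (Sum.inr r) (ρR r).toReal)

/-- PP/FIFO outflow at an extended state -/
noncomputable def foutExt (ρO : O → ℝ) (ρR : R → ℝ≥0∞) : O ⊕ R → ℝ :=
  N.foutGen (N.δext ρO ρR) ρO

/-- PP/FIFO inflow at an extended state -/
noncomputable def finExt (ρO : O → ℝ) (ρR : R → ℝ≥0∞) (l : O) : ℝ :=
  N.finGen (N.δext ρO ρR) ρO l

/-- generalized equilibrium (Definition 3): ordinary links balance and each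
onramp either transmits its input flow or has infinite density -/
def IsGenEquilibrium (d : R → ℝ) (ρO : O → ℝ) (ρR : R → ℝ≥0∞) : Prop :=
  (∀ l : O, ρO l ∈ Set.Icc 0 (N.ρjam l)) ∧
  (∀ l : O, N.foutExt ρO ρR (Sum.inl l) = N.finExt ρO ρR l) ∧
  (∀ r : R, N.foutExt ρO ρR (Sum.inr r) = d r ∨
      (N.foutExt ρO ρR (Sum.inr r) < d r ∧ ρR r = ⊤))

/-! ### Ramp metering -/

/-- demand vector for the metered network with metering rates `m` -/
noncomputable def δextM (m : R → ℝ) (ρO : O → ℝ) (ρR : R → ℝ≥0∞) : O ⊕ R → ℝ :=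
  Sum.elim (fun l => N.Φout (Sum.inl l) (ρO l))
    (fun r => min (if ρR r = ⊤ then N.Φbar r else N.Φout (Sum.inr r) (ρR r).toReal) (m r))

/-- PP/FIFO outflow of the metered network -/
noncomputable def foutM (m : R → ℝ) (ρO : O → ℝ) (ρR : R → ℝ≥0∞) : O ⊕ R → ℝ :=
  N.foutGen (N.δextM m ρO ρR) ρO

/-- PP/FIFO inflow of the metered network -/
noncomputable def finM (m : R → ℝ) (ρO : O → ℝ) (ρR : R → ℝ≥0∞) (l : O) : ℝ :=
  N.finGen (N.δextM m ρO ρR) ρO l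

/-- generalized equilibrium of the metered network -/
def IsGenEquilibriumM (m : R → ℝ) (d : R → ℝ) (ρO : O → ℝ) (ρR : R → ℝ≥0∞) : Prop :=
  (∀ l : O, ρO l ∈ Set.Icc 0 (N.ρjam l)) ∧
  (∀ l : O, N.foutM m ρO ρR (Sum.inl l) = N.finM m ρO ρR l) ∧
  (∀ r : R, N.foutM m ρO ρR (Sum.inr r) = d r ∨
      (N.foutM m ρO ρR (Sum.inr r) < d r ∧ ρR r = ⊤))

end TrafficNetwork

namespace TrafficNetwork

variable {V O R : Type} [Fintype V] [Fintype O] [Fintype R]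
  [DecidableEq V] [DecidableEq O] [DecidableEq R]
variable (N : TrafficNetwork V O R)

/-- The supremum defining the PP/FIFO scale factor is attained when supplies are nonnegative. -/
theorem αgen_mem (δ : O ⊕ R → ℝ) (ρO : O → ℝ) (v : V)
    (h : ∀ k, 0 ≤ N.Φin k (ρO k)) :
    N.αgen δ ρO v ∈ Set.Icc (0 : ℝ) 1 ∧
      ∀ k ∈ N.Lout v, N.αgen δ ρO v * ∑ j ∈ N.Lin v, N.β j k * δ j ≤ N.Φin k (ρO k) := by
  have hclosed : IsClosed {a : ℝ | a ∈ Set.Icc (0 : ℝ) 1 ∧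
      ∀ k ∈ N.Lout v, a * ∑ j ∈ N.Lin v, N.β j k * δ j ≤ N.Φin k (ρO k)} := by
    have hfeas : IsClosed {a : ℝ |
        ∀ k ∈ N.Lout v, a * ∑ j ∈ N.Lin v, N.β j k * δ j ≤ N.Φin k (ρO k)} := by
      simp only [Set.ofPred_forall]
      exact isClosed_iInter fun k => isClosed_iInter fun _ =>
        isClosed_le (by fun_prop) continuous_const
    exact isClosed_Icc.inter hfeas
  exact hclosed.csSup_mem ⟨0, ⟨le_rfl, zero_le_one⟩, fun k _ => by simpa using h k⟩
    ⟨1, fun a ha => ha.1.2⟩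

/-- If the scale factor is less than one, the supply constraint of some outgoing link is tight. -/
theorem exists_supply_eq_of_αgen_lt_one (δ : O ⊕ R → ℝ) (ρO : O → ℝ) (v : V)
    (h : ∀ k, 0 ≤ N.Φin k (ρO k)) (hα : N.αgen δ ρO v < 1) :
    ∃ k ∈ N.Lout v, N.αgen δ ρO v * ∑ j ∈ N.Lin v, N.β j k * δ j = N.Φin k (ρO k) := by
  by_contra! hne
  obtain ⟨hmem, hle⟩ := N.αgen_mem δ ρO v h
  have hev : ∀ᶠ a in nhds (N.αgen δ ρO v),
      ∀ k ∈ N.Lout v, a * ∑ j ∈ N.Lin v, N.β j k * δ j < N.Φin k (ρO k) := by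
    rw [Filter.eventually_all_finset]
    intro k hk
    have hcont : Continuous fun a : ℝ => a * ∑ j ∈ N.Lin v, N.β j k * δ j := by fun_prop
    exact hcont.continuousAt.eventually_lt_const (lt_of_le_of_ne (hle k hk) (hne k hk))
  obtain ⟨a, ⟨hak, ha1⟩, haα⟩ := (((hev.and (eventually_lt_nhds hα)).filter_mono
    nhdsWithin_le_nhds).and (self_mem_nhdsWithin (s := Set.Ioi (N.αgen δ ρO v)))).exists
  have hle_α : a ≤ N.αgen δ ρO v := le_csSup ⟨1, fun b hb => hb.1.2⟩
    ⟨⟨hmem.1.trans (le_of_lt haα), ha1.le⟩, fun k hk => (hak k hk).le⟩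
  exact absurd haα (not_lt.mpr hle_α)

/-- The inflow of a link is its scaled incoming demand. -/
theorem finGen_eq (δ : O ⊕ R → ℝ) (ρO : O → ℝ) (k : O) :
    N.finGen δ ρO k =
      N.αgen δ ρO (N.tail k) * ∑ j ∈ N.Lin (N.tail k), N.β j k * δ j := by
  rw [finGen, Finset.mul_sum]
  refine Finset.sum_congr rfl fun j hj => ?_
  have hj' : N.head j = N.tail k := by simpa [Lin] using hj
  rw [foutGen, hj']
  ring

/-- The density at which demand equals supply is unique. -/
theorem IsCrit.unique {N : TrafficNetwork V O R} {k : O} {x y : ℝ}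
    (hx : N.IsCrit k x) (hy : N.IsCrit k y) : x = y := by
  have key : ∀ {a b : ℝ}, N.IsCrit k a → N.IsCrit k b → ¬ a < b := fun ha hb hab => by
    have h1 := N.Φout_strictMono k ha.1 hb.1 hab
    have h2 := N.Φin_strictAnti k ha.1 hb.1 hab
    linarith [ha.2, hb.2]
  exact le_antisymm (not_lt.mp (key hy hx)) (not_lt.mp (key hx hy))

theorem memD.demand_nonneg {N : TrafficNetwork V O R} {ρ : O ⊕ R → ℝ} (hρ : N.memD ρ)
    (l : O ⊕ R) : 0 ≤ N.Φout l (ρ l) := by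
  cases l with
  | inl k => exact N.Φout_nonneg k _ (hρ.2 k)
  | inr r => exact N.ΦoutR_nonneg r _ (hρ.1 r)

theorem memD.supply_nonneg {N : TrafficNetwork V O R} {ρ : O ⊕ R → ℝ} (hρ : N.memD ρ)
    (k : O) : 0 ≤ N.Φin k (ρ (Sum.inl k)) :=
  N.Φin_nonneg k _ (hρ.2 k)

theorem memD.fout_le_demand {N : TrafficNetwork V O R} {ρ : O ⊕ R → ℝ} (hρ : N.memD ρ)
    (l : O ⊕ R) : N.fout ρ l ≤ N.Φout l (ρ l) :=
  mul_le_of_le_one_left (hρ.demand_nonneg l)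
    (N.αgen_mem _ (fun k => ρ (Sum.inl k)) _ hρ.supply_nonneg).1.2

/-- Downstream of a congested link there is a link whose inflow equals its supply. -/
theorem memD.exists_fin_eq_supply {N : TrafficNetwork V O R} {ρ : O ⊕ R → ℝ} (hρ : N.memD ρ)
    {l : O ⊕ R} (hl : N.fout ρ l < N.Φout l (ρ l)) :
    ∃ k : O, N.tail k = N.head l ∧ N.fin ρ k = N.Φin k (ρ (Sum.inl k)) := by
  have hα : N.αgen (N.demand ρ) (fun k => ρ (Sum.inl k)) (N.head l) < 1 := by
    by_contra! h
    exact absurd (le_mul_of_one_le_left (hρ.demand_nonneg l) h) (not_le.mpr hl)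
  obtain ⟨k, hk, heq⟩ := N.exists_supply_eq_of_αgen_lt_one _ _ _ hρ.supply_nonneg hα
  have hk' : N.tail k = N.head l := by simpa [Lout] using hk
  exact ⟨k, hk', by rw [fin, finGen_eq, hk', heq]⟩

end TrafficNetwork

/-- **claim in the proof of Proposition 3.** Let `{fe_l}` be an
equilibrium flow with corresponding equilibrium densities `{ρe_l}`.  If
`fe_l < Φout_l(ρe_l)` for some link `l ∈ L`, then there exists an ordinary
link `k ∈ O` with `fe_k = Φcrit_k`. -/
theorem stmt7 {V O R : Type} [Fintype V] [Fintype O] [Fintype R]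
    [DecidableEq V] [DecidableEq O] [DecidableEq R]
    (N : TrafficNetwork V O R)
    (d : R → ℝ) (hd : ∀ r, 0 ≤ d r)
    (ρcrit : O → ℝ) (hcrit : ∀ l, N.IsCrit l (ρcrit l))
    (ρe : O ⊕ R → ℝ) (he : N.IsEquilibrium d ρe)
    (l : O ⊕ R) (hl : N.fout ρe l < N.Φout l (ρe l)) :
    ∃ k : O, N.fout ρe (Sum.inl k) = N.Φin k (ρcrit k) := by
  obtain ⟨rank, hrank⟩ := N.acyclic
  obtain ⟨M, hM⟩ : ∃ M, ∀ v, rank v ≤ M :=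
    ⟨Finset.univ.sup rank, fun v => Finset.le_sup (Finset.mem_univ v)⟩
  obtain ⟨hD, -, hbal⟩ := he
  induction hn : M - rank (N.head l) using Nat.strong_induction_on generalizing l with
  | _ n ih =>
    obtain ⟨k, hk, hfin⟩ := hD.exists_fin_eq_supply hl
    have hflow : N.fout ρe (Sum.inl k) = N.Φin k (ρe (Sum.inl k)) := (hbal k).trans hfin
    rcases (hD.fout_le_demand (Sum.inl k)).lt_or_eq with hlt | heq
    · refine ih _ ?_ (Sum.inl k) hlt rfl
      have h1 := hrank k
      have h2 := hM (N.head (Sum.inl k))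
      rw [hk] at h1
      omega
    · have hx : N.IsCrit k (ρe (Sum.inl k)) := ⟨hD.2 k, heq.symm.trans hflow⟩
      exact ⟨k, by rw [hflow, hx.unique (hcrit k)]⟩
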